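/- Let 1 < α ≤ 2, β₁ > 1/(α−1) and β₂ > 1/(α−1), and let (m_n) be a sequence of positive integers such that m_n^{−β₂}/n^{−β₁} → 0 as n → ∞. Then lim_{n→∞} ρ(n,−m_n)/(n^{−β₁(α−1)} m_n^{−β₂}) = Σ_{i=0}^∞ Σ_{j=0}^∞ w_{(∞,j)}^{α−1} w_{(i,∞)} (1+j)^{−β₂(α−1)} (1+i)^{−β₁}. -/

import Mathlib

open Filter MeasureTheory Real Set

/-- The kernel `V(x,y) = xy/(x^2+y^2)^{(2-α)/2}` with `V(0,0)=0`. -/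
noncomputable def V (α : ℝ) : ℝ → ℝ → ℝ := fun x y =>
  if x = 0 ∧ y = 0 then 0 else x * y / (x ^ 2 + y ^ 2) ^ ((2 - α) / 2)

theorem V_scale (α s t X Y : ℝ) (hs : 0 < s) (hX : X ≠ 0) :
    V α (s * X) (t * Y) =
      s ^ (α - 1) * t * (X * Y / (X ^ 2 + (t / s * Y) ^ 2) ^ ((2 - α) / 2)) := by
  unfold V
  have h0 : ¬ (s * X = 0 ∧ t * Y = 0) := fun h => (mul_ne_zero hs.ne' hX) h.1
  rw [if_neg h0]
  have h1 : (s * X) ^ 2 + (t * Y) ^ 2 = s ^ 2 * (X ^ 2 + (t / s * Y) ^ 2) := by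
    field_simp
  have hX2 : 0 < X ^ 2 + (t / s * Y) ^ 2 := by positivity
  rw [h1, Real.mul_rpow (by positivity) hX2.le]
  have h2 : (s ^ 2) ^ ((2 - α) / 2) = s ^ (2 - α) := by
    rw [← Real.rpow_natCast, ← Real.rpow_mul hs.le]
    congr 1
    push_cast
    ring
  rw [h2]
  have h3 : s = s ^ (α - 1) * s ^ (2 - α) := by
    rw [← Real.rpow_add hs]
    norm_num
  have h4 : s ^ (2 - α) ≠ 0 := (Real.rpow_pos_of_pos hs _).ne'
  have h5 := (Real.rpow_pos_of_pos hX2 ((2 - α) / 2)).ne'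
  rw [mul_div_assoc', div_eq_div_iff (mul_ne_zero h4 h5) h5]
  linear_combination (X * t * Y * (X ^ 2 + (t / s * Y) ^ 2) ^ ((2 - α) / 2)) * h3

theorem V_bound (α x y : ℝ) (h2 : α ≤ 2) (hx : x ≠ 0) :
    |V α x y| ≤ |x| ^ (α - 1) * |y| := by
  unfold V
  rw [if_neg (fun h => hx h.1)]
  have hx' : 0 < |x| := abs_pos.mpr hx
  have h1 : |x| ^ (2 - α) ≤ (x ^ 2 + y ^ 2) ^ ((2 - α) / 2) := by
    have : |x| ^ (2 - α) = (x ^ 2) ^ ((2 - α) / 2) := by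
      rw [← sq_abs, ← Real.rpow_natCast, ← Real.rpow_mul hx'.le]
      congr 1
      push_cast
      ring
    rw [this]
    exact Real.rpow_le_rpow (by positivity) (by nlinarith [sq_nonneg y]) (by linarith)
  have h3 : |x| = |x| ^ (α - 1) * |x| ^ (2 - α) := by
    rw [← Real.rpow_add hx']
    norm_num
  have h4 : 0 < |x| ^ (2 - α) := Real.rpow_pos_of_pos hx' _
  have h5 : 0 < |x| ^ (α - 1) := Real.rpow_pos_of_pos hx' _
  rw [abs_div, abs_mul, abs_of_pos (lt_of_lt_of_le h4 h1), div_le_iff₀ (lt_of_lt_of_le h4 h1)]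
  calc |x| * |y| = (|x| ^ (α - 1) * |y|) * |x| ^ (2 - α) := by
        linear_combination |y| * h3
    _ ≤ _ := mul_le_mul_of_nonneg_left h1 (by positivity)

theorem w_bdd (w : ℕ → ℕ → ℝ)
    (hA1 : Tendsto (fun p : ℕ × ℕ => w p.1 p.2) (atTop ×ˢ atTop) (nhds 1))
    (winf : ℕ → ℝ) (hA2 : ∀ i, Tendsto (fun j => w i j) atTop (nhds (winf i)))
    (wco : ℕ → ℝ) (hA3 : ∀ j, Tendsto (fun i => w i j) atTop (nhds (wco j))) :
    ∃ C, 0 < C ∧ ∀ i j, |w i j| ≤ C := by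
  have h1 : ∀ᶠ p : ℕ × ℕ in atTop ×ˢ atTop, |w p.1 p.2| < 2 :=
    hA1.abs.eventually_lt_const (by norm_num)
  rw [prod_atTop_atTop_eq, eventually_atTop] at h1
  obtain ⟨⟨a, b⟩, hab⟩ := h1
  have h2 : ∀ i, ∃ C, ∀ j, |w i j| ≤ C := by
    intro i
    obtain ⟨C, hC⟩ := (hA2 i).abs.bddAbove_range
    exact ⟨C, fun j => hC ⟨j, rfl⟩⟩
  have h3 : ∀ j, ∃ C, ∀ i, |w i j| ≤ C := by
    intro j
    obtain ⟨C, hC⟩ := (hA3 j).abs.bddAbove_range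
    exact ⟨C, fun i => hC ⟨i, rfl⟩⟩
  choose A hA using h2
  choose B hB using h3
  have hA0 : ∀ i, 0 ≤ A i := fun i => (abs_nonneg _).trans (hA i 0)
  have hB0 : ∀ i, 0 ≤ B i := fun i => (abs_nonneg _).trans (hB i 0)
  have sA : 0 ≤ ∑ i ∈ Finset.range a, A i := Finset.sum_nonneg fun i _ => hA0 i
  have sB : 0 ≤ ∑ i ∈ Finset.range b, B i := Finset.sum_nonneg fun i _ => hB0 i
  refine ⟨2 + ∑ i ∈ Finset.range a, A i + ∑ i ∈ Finset.range b, B i, by linarith, ?_⟩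
  intro i j
  by_cases hi : i < a
  · have := Finset.single_le_sum (f := A) (fun i _ => hA0 i) (Finset.mem_range.mpr hi)
    linarith [hA i j]
  by_cases hj : j < b
  · have := Finset.single_le_sum (f := B) (fun i _ => hB0 i) (Finset.mem_range.mpr hj)
    linarith [hB j i]
  have := hab (i, j) ⟨not_lt.mp hi, not_lt.mp hj⟩
  simp only at this
  linarith

theorem ratio_tendsto (β : ℝ) (i : ℕ) :
    Tendsto (fun n : ℕ => ((1 + ((i + n : ℕ) : ℝ)) / (n : ℝ)) ^ (-β)) atTop (nhds 1) := by
  have h : Tendsto (fun n : ℕ => (1 + (i : ℝ)) / (n : ℝ) + 1) atTop (nhds (0 + 1)) :=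
    (tendsto_const_div_atTop_nhds_zero_nat _).add_const 1
  rw [zero_add] at h
  have h2 : Tendsto (fun n : ℕ => (1 + ((i + n : ℕ) : ℝ)) / (n : ℝ)) atTop (nhds 1) := by
    refine h.congr' ?_
    filter_upwards [eventually_ge_atTop 1] with n hn
    have : (n : ℝ) ≠ 0 := by positivity
    push_cast
    field_simp
    ring
  have := h2.rpow_const (p := -β) (Or.inl one_ne_zero)
  simpa using this

theorem split_pow (β : ℝ) (i n : ℕ) (hn : 1 ≤ n) :
    (1 + ((i + n : ℕ) : ℝ)) ^ (-β) =
      (n : ℝ) ^ (-β) * ((1 + ((i + n : ℕ) : ℝ)) / (n : ℝ)) ^ (-β) := by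
  have hn' : (0 : ℝ) < n := by positivity
  rw [← Real.mul_rpow hn'.le (by positivity)]
  congr 1
  field_simp

theorem summable_one_add (p : ℝ) (hp : 1 < p) :
    Summable (fun i : ℕ => (1 + (i : ℝ)) ^ (-p)) := by
  have h := (summable_nat_add_iff (f := fun i : ℕ => (i : ℝ) ^ (-p)) 1).mpr
    (Real.summable_nat_rpow.mpr (by linarith))
  refine h.congr fun i => ?_
  push_cast
  rw [add_comm]

theorem stmt9 (α β₁ β₂ : ℝ)
    (hα : 1 < α) (hα2 : α ≤ 2)
    (hβ₁ : 1 / (α - 1) < β₁) (hβ₂ : 1 / (α - 1) < β₂)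
    (w : ℕ → ℕ → ℝ) (hw : ∀ i j, w i j ≠ 0)
    (hA1 : Tendsto (fun p : ℕ × ℕ => w p.1 p.2) (atTop ×ˢ atTop) (nhds 1))
    (winf : ℕ → ℝ)
    (hA2 : ∀ i, Tendsto (fun j => w i j) atTop (nhds (winf i)) ∧ 0 < winf i)
    (wco : ℕ → ℝ)
    (hA3 : ∀ j, Tendsto (fun i => w i j) atTop (nhds (wco j)) ∧ 0 < wco j)
    (c : ℕ → ℕ → ℝ)
    (hc : ∀ i j, c i j = w i j * (1 + (i : ℝ)) ^ (-β₁) * (1 + (j : ℝ)) ^ (-β₂))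
    (ρ : ℕ → ℕ → ℝ)
    (hsum : ∀ n m : ℕ, 1 ≤ n → 1 ≤ m →
      Summable (fun q : ℕ × ℕ => V α (c (q.1 + n) q.2) (c q.1 (q.2 + m))))
    (hρ : ∀ n m : ℕ, 1 ≤ n → 1 ≤ m →
      ρ n m = ∑' i : ℕ, ∑' j : ℕ, V α (c (i + n) j) (c i (j + m)))
    (m : ℕ → ℕ) (hm : ∀ n, 1 ≤ m n)
    (hratio : Tendsto (fun n : ℕ => (m n : ℝ) ^ (-β₂) / (n : ℝ) ^ (-β₁))
      atTop (nhds 0))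
    :
    Tendsto (fun n : ℕ => ρ n (m n) / ((n : ℝ) ^ (-(β₁ * (α - 1))) * (m n : ℝ) ^ (-β₂)))
      atTop
      (nhds (∑' i : ℕ, ∑' j : ℕ,
        wco j ^ (α - 1) * winf i *
          (1 + (j : ℝ)) ^ (-(β₂ * (α - 1))) * (1 + (i : ℝ)) ^ (-β₁))) := by
  have ha : 0 < α - 1 := by linarith
  have hb1 : 1 < β₁ * (α - 1) := by rwa [div_lt_iff₀ ha] at hβ₁
  have hb2 : 1 < β₂ * (α - 1) := by rwa [div_lt_iff₀ ha] at hβ₂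
  have hβ1' : 1 < β₁ := by nlinarith
  have hβ2' : 1 < β₂ := by nlinarith
  obtain ⟨C, hC0, hC⟩ := w_bdd w hA1 winf (fun i => (hA2 i).1) wco (fun i => (hA3 i).1)
  -- m → ∞
  have hm0 : Tendsto (fun n => (m n : ℝ) ^ (-β₂)) atTop (nhds 0) := by
    have h1 : Tendsto (fun n : ℕ => (n : ℝ) ^ (-β₁)) atTop (nhds 0) :=
      (tendsto_rpow_neg_atTop (by linarith)).comp tendsto_natCast_atTop_atTop
    have h2 := hratio.mul h1
    rw [mul_zero] at h2
    refine h2.congr' ?_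
    filter_upwards [eventually_ge_atTop 1] with n hn
    have : (0 : ℝ) < n := by positivity
    exact div_mul_cancel₀ _ (Real.rpow_pos_of_pos this _).ne'
  have hmtop : Tendsto m atTop atTop := by
    rw [tendsto_atTop]
    intro b
    have hpos : (0 : ℝ) < ((b : ℝ) + 1) ^ (-β₂) := by positivity
    filter_upwards [hm0.eventually_lt_const hpos] with n hn
    by_contra hlt
    push Not at hlt
    have h1 : (0 : ℝ) < m n := by exact_mod_cast hm n
    have h2 : (m n : ℝ) ≤ b + 1 := by
      have : (m n : ℝ) ≤ b := by exact_mod_cast hlt.le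
      linarith
    have := Real.rpow_le_rpow_of_nonpos h1 h2 (by linarith : -β₂ ≤ 0)
    linarith
  let D : ℕ → ℝ := fun n => (n : ℝ) ^ (-(β₁ * (α - 1))) * (m n : ℝ) ^ (-β₂)
  let F : ℕ → ℕ × ℕ → ℝ := fun n q => V α (c (q.1 + n) q.2) (c q.1 (q.2 + m n)) / D n
  let G : ℕ × ℕ → ℝ := fun q => wco q.2 ^ (α - 1) * winf q.1 *
          (1 + (q.2 : ℝ)) ^ (-(β₂ * (α - 1))) * (1 + (q.1 : ℝ)) ^ (-β₁)
  let B : ℕ × ℕ → ℝ := fun q => C ^ (α - 1) * C *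
    ((1 + (q.1 : ℝ)) ^ (-β₁) * (1 + (q.2 : ℝ)) ^ (-(β₂ * (α - 1))))
  have hBsum : Summable B :=
    ((summable_one_add β₁ hβ1').mul_of_nonneg (summable_one_add _ hb2)
      (fun i => by positivity) (fun i => by positivity)).mul_left _
  have hcne : ∀ i j, c i j ≠ 0 := by
    intro i j
    rw [hc]
    have h1 : (0 : ℝ) < (1 + (i : ℝ)) ^ (-β₁) := by positivity
    have h2 : (0 : ℝ) < (1 + (j : ℝ)) ^ (-β₂) := by positivity
    exact mul_ne_zero (mul_ne_zero (hw i j) h1.ne') h2.ne'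
  have hcb : ∀ i j, |c i j| ≤ C * (1 + (i : ℝ)) ^ (-β₁) * (1 + (j : ℝ)) ^ (-β₂) := by
    intro i j
    have h1 : (0 : ℝ) < (1 + (i : ℝ)) ^ (-β₁) := by positivity
    have h2 : (0 : ℝ) < (1 + (j : ℝ)) ^ (-β₂) := by positivity
    rw [hc, abs_mul, abs_mul, abs_of_pos h1, abs_of_pos h2]
    gcongr
    exact hC i j
  have hFB : ∀ᶠ n in atTop, ∀ q, ‖F n q‖ ≤ B q := by
    filter_upwards [eventually_ge_atTop 1] with n hn
    rintro ⟨i, j⟩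
    have hn' : (0 : ℝ) < n := by positivity
    have hm' : (0 : ℝ) < m n := by exact_mod_cast hm n
    have hD : 0 < D n := mul_pos (Real.rpow_pos_of_pos hn' _) (Real.rpow_pos_of_pos hm' _)
    simp only [F, B, norm_div, Real.norm_eq_abs]
    rw [abs_of_pos hD, div_le_iff₀ hD]
    refine (V_bound α _ _ hα2 (hcne _ _)).trans ?_
    have e1 : |c (i + n) j| ≤ C * (n : ℝ) ^ (-β₁) * (1 + (j : ℝ)) ^ (-β₂) := by
      refine (hcb _ _).trans ?_
      gcongr ?_ * ?_ * ?_
      exact Real.rpow_le_rpow_of_nonpos hn' (by push_cast; linarith [Nat.cast_nonneg (α := ℝ) i])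
        (by linarith)
    have e2 : |c i (j + m n)| ≤ C * (1 + (i : ℝ)) ^ (-β₁) * (m n : ℝ) ^ (-β₂) := by
      refine (hcb _ _).trans ?_
      gcongr ?_ * ?_ * ?_
      exact Real.rpow_le_rpow_of_nonpos hm' (by push_cast; linarith [Nat.cast_nonneg (α := ℝ) j])
        (by linarith)
    have e3 : |c (i + n) j| ^ (α - 1) ≤
        C ^ (α - 1) * (n : ℝ) ^ (-(β₁ * (α - 1))) * (1 + (j : ℝ)) ^ (-(β₂ * (α - 1))) := by
      refine (Real.rpow_le_rpow (abs_nonneg _) e1 ha.le).trans_eq ?_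
      rw [Real.mul_rpow (by positivity) (by positivity), Real.mul_rpow hC0.le (by positivity),
        ← Real.rpow_mul hn'.le, ← Real.rpow_mul (by positivity), neg_mul, neg_mul]
    refine (mul_le_mul e3 e2 (abs_nonneg _) (by positivity)).trans_eq ?_
    simp only [D]
    ring
  have hFG : ∀ q, Tendsto (fun n => F n q) atTop (nhds (G q)) := by
    rintro ⟨i, j⟩
    let X : ℕ → ℝ := fun n =>
      w (i + n) j * ((1 + ((i + n : ℕ) : ℝ)) / (n : ℝ)) ^ (-β₁) * (1 + (j : ℝ)) ^ (-β₂)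
    let Y : ℕ → ℝ := fun n =>
      w i (j + m n) * (1 + (i : ℝ)) ^ (-β₁) *
        ((1 + ((j + m n : ℕ) : ℝ)) / (m n : ℝ)) ^ (-β₂)
    have hX : Tendsto X atTop (nhds (wco j * 1 * (1 + (j : ℝ)) ^ (-β₂))) := by
      refine Tendsto.mul_const _ (Tendsto.mul ?_ (ratio_tendsto β₁ i))
      exact (hA3 j).1.comp (tendsto_atTop_mono (fun n => Nat.le_add_left n i) tendsto_id)
    have hY : Tendsto Y atTop (nhds (winf i * (1 + (i : ℝ)) ^ (-β₁) * 1)) := by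
      refine Tendsto.mul (Tendsto.mul_const _ ?_) ((ratio_tendsto β₂ j).comp hmtop)
      exact (hA2 i).1.comp (tendsto_atTop_mono (fun n => Nat.le_add_left (m n) j) hmtop)
    rw [mul_one] at hX hY
    set x := wco j * (1 + (j : ℝ)) ^ (-β₂) with hx
    set y := winf i * (1 + (i : ℝ)) ^ (-β₁) with hy
    have hx0 : 0 < x := mul_pos (hA3 j).2 (by positivity)
    have hlim : Tendsto (fun n => X n * Y n /
        (X n ^ 2 + ((m n : ℝ) ^ (-β₂) / (n : ℝ) ^ (-β₁) * Y n) ^ 2) ^ ((2 - α) / 2)) atTop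
        (nhds (x * y / (x ^ 2 + (0 * y) ^ 2) ^ ((2 - α) / 2))) := by
      have hp : 0 < x ^ 2 + (0 * y) ^ 2 := by positivity
      refine (hX.mul hY).div ?_ (Real.rpow_pos_of_pos hp _).ne'
      exact ((hX.pow 2).add ((hratio.mul hY).pow 2)).rpow_const (Or.inl hp.ne')
    have hval : x * y / (x ^ 2 + (0 * y) ^ 2) ^ ((2 - α) / 2) = G (i, j) := by
      have h1 : x ^ 2 + (0 * y) ^ 2 = x ^ 2 := by ring
      have h2 : (x ^ 2) ^ ((2 - α) / 2) = x ^ (2 - α) := by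
        rw [← Real.rpow_natCast, ← Real.rpow_mul hx0.le]
        congr 1
        push_cast
        ring
      have h3 : x = x ^ (α - 1) * x ^ (2 - α) := by
        rw [← Real.rpow_add hx0]
        norm_num
      have h4 : x ^ (2 - α) ≠ 0 := (Real.rpow_pos_of_pos hx0 _).ne'
      have h5 : x ^ (α - 1) = wco j ^ (α - 1) * (1 + (j : ℝ)) ^ (-(β₂ * (α - 1))) := by
        rw [hx, Real.mul_rpow (hA3 j).2.le (by positivity), ← Real.rpow_mul (by positivity),
          neg_mul]
      have h6 : x * y / x ^ (2 - α) = x ^ (α - 1) * y := by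
        rw [div_eq_iff h4]
        linear_combination y * h3
      rw [h1, h2, h6, h5, hy]
      simp only [G]
      ring
    rw [← hval]
    refine hlim.congr' ?_
    filter_upwards [eventually_ge_atTop 1] with n hn
    have hn' : (0 : ℝ) < n := by positivity
    have hm' : (0 : ℝ) < m n := by exact_mod_cast hm n
    have hD : 0 < D n := mul_pos (Real.rpow_pos_of_pos hn' _) (Real.rpow_pos_of_pos hm' _)
    have hcX : c (i + n) j = (n : ℝ) ^ (-β₁) * X n := by
      rw [hc, split_pow β₁ i n hn]
      simp only [X]
      ring
    have hcY : c i (j + m n) = (m n : ℝ) ^ (-β₂) * Y n := by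
      rw [hc, split_pow β₂ j (m n) (hm n)]
      simp only [Y]
      ring
    have hXne : X n ≠ 0 := by
      intro h
      apply hcne (i + n) j
      rw [hcX, h, mul_zero]
    simp only [F]
    rw [eq_div_iff hD.ne', hcX, hcY, V_scale _ _ _ _ _ (Real.rpow_pos_of_pos hn' _) hXne,
      ← Real.rpow_mul hn'.le, neg_mul]
    simp only [D]
    ring
  have hGB : ∀ q, ‖G q‖ ≤ B q := fun q =>
    le_of_tendsto (hFG q).norm (hFB.mono fun n h => h q)
  have hGsum : Summable G := Summable.of_norm_bounded hBsum hGB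
  have key := tendsto_tsum_of_dominated_convergence hBsum hFG hFB
  rw [hGsum.tsum_prod] at key
  refine key.congr' ?_
  filter_upwards [eventually_ge_atTop 1] with n hn
  rw [hρ n (m n) hn (hm n), ← (hsum n (m n) hn (hm n)).tsum_prod, ← tsum_div_const]
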